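/- Let n ≥ 1, B > -(n-2)²/4, 0 ≤ A < n−1+2ρ with ρ = ((2-n)+√((n-2)²+4B))/2, α = (n+A−1+2ρ)/2, γ = n−1+2ρ, and fix λ > 1, p > (n+ρ)/(n+ρ−1), β < γ − α and β₁ > γ − α − 1/p, with p' = p/(p−1). With Ψ_β and S(T;β₁,β) defined as in the context, there is a constant C (independent of T) such that S(T;β₁,β) ≤ C T^{(ρ+n)/p' − (n−A+2ρ+1)/2 + β/p} for all T ≥ 1. -/

import Mathlib

open MeasureTheory

/-- The hypergeometric function via the Euler integral representation,
`F(α,β,γ;z) = (Γ(γ)/(Γ(α)Γ(γ−α))) ∫₀¹ s^(α−1) (1−s)^(γ−α−1) (1−zs)^(−β) ds`,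
valid for `γ > α > 0` and `z < 1`. -/
noncomputable def hyperF (α β γ z : ℝ) : ℝ :=
  (Real.Gamma γ / (Real.Gamma α * Real.Gamma (γ - α))) *
    ∫ s in (0 : ℝ)..1, s ^ (α - 1) * (1 - s) ^ (γ - α - 1) * (1 - z * s) ^ (-β)

/-- The test function `Ψ_β(t,x;λ) = |x|^ρ (t+|x|+λ)^(−β) F(α,β,γ; 2|x|/(t+|x|+λ))`
on `ℝⁿ`. -/
noncomputable def Psi (n : ℕ) (α γ ρ β lam : ℝ) (t : ℝ)
    (x : EuclideanSpace ℝ (Fin n)) : ℝ :=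
  ‖x‖ ^ ρ * (t + ‖x‖ + lam) ^ (-β) * hyperF α β γ (2 * ‖x‖ / (t + ‖x‖ + lam))

/-- The quantity `S(T;β₁,β)` built from the three space-time integrals of the
test functions over `[T/2,T] × B(0,1+t)`. -/
noncomputable def Sfun (n : ℕ) (α γ ρ lam p p' β₁ β T : ℝ) : ℝ :=
  T ^ (-2 : ℝ) *
      (∫ t in (T/2)..T, ∫ x in Metric.ball (0 : EuclideanSpace ℝ (Fin n)) (1 + t),
          Psi n α γ ρ β₁ lam t x ^ p' * Psi n α γ ρ β lam t x ^ (-(p' / p))) ^ (1 / p')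
    + T ^ (-1 : ℝ) *
      (∫ t in (T/2)..T, ∫ x in Metric.ball (0 : EuclideanSpace ℝ (Fin n)) (1 + t),
          ‖x‖ ^ (-p') * Psi n α γ ρ β₁ lam t x ^ p' *
            Psi n α γ ρ β lam t x ^ (-(p' / p))) ^ (1 / p')
    + T ^ (-1 : ℝ) *
      (∫ t in (T/2)..T, ∫ x in Metric.ball (0 : EuclideanSpace ℝ (Fin n)) (1 + t),
          |deriv (fun t' => Psi n α γ ρ β₁ lam t' x) t| ^ p' *
            Psi n α γ ρ β lam t x ^ (-(p' / p))) ^ (1 / p')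

theorem intervalIntegrable_rpow_mul_one_sub_rpow {α κ : ℝ} (hα : 0 < α) (hκ : 0 < κ) :
    IntervalIntegrable (fun s : ℝ => s ^ (α - 1) * (1 - s) ^ (κ - 1)) volume 0 1 := by
  have key : ∀ a b : ℝ, 0 < a → IntervalIntegrable
      (fun s : ℝ => s ^ (a - 1) * (1 - s) ^ (b - 1)) volume 0 (1 / 2) := by
    intro a b ha
    apply IntervalIntegrable.mul_continuousOn
    · exact intervalIntegral.intervalIntegrable_rpow' (by linarith)
    · intro s hs
      rw [Set.uIcc_of_le (by norm_num)] at hs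
      exact (ContinuousAt.rpow_const (by fun_prop)
        (Or.inl (by linarith [hs.2]))).continuousWithinAt
  refine (key α κ hα).trans ?_
  have h := ((key κ α hκ).comp_sub_left 1).symm
  norm_num at h
  simpa only [one_div, mul_comm] using h

theorem intervalIntegrable_jacobi_mul {α κ : ℝ} (hα : 0 < α) (hκ : 0 < κ) {g : ℝ → ℝ} (b : ℝ)
    (hg : Continuous g) (hpos : ∀ s ∈ Set.Icc (0 : ℝ) 1, 0 < g s) :
    IntervalIntegrable (fun s : ℝ => s ^ (α - 1) * (1 - s) ^ (κ - 1) * g s ^ b) volume 0 1 := by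
  apply (intervalIntegrable_rpow_mul_one_sub_rpow hα hκ).mul_continuousOn
  intro s hs
  rw [Set.uIcc_of_le (by norm_num)] at hs
  exact (ContinuousAt.rpow_const hg.continuousAt (Or.inl (hpos s hs).ne')).continuousWithinAt

theorem integral_rpow_mul_add_rpow_neg_le {κ b x : ℝ} (hκ : 0 < κ) (hb : κ < b)
    (hx : 0 < x) (hx1 : x ≤ 1) :
    ∫ u in (0 : ℝ)..1, u ^ (κ - 1) * (x + u) ^ (-b) ≤ (1 / κ + 1 / (b - κ)) * x ^ (κ - b) := by
  have hint : ∀ c d : ℝ, 0 ≤ c → 0 ≤ d → IntervalIntegrable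
      (fun u : ℝ => u ^ (κ - 1) * (x + u) ^ (-b)) volume c d := by
    intro c d hc hd
    apply IntervalIntegrable.mul_continuousOn
    · exact intervalIntegral.intervalIntegrable_rpow' (by linarith)
    · intro s hs
      have : 0 ≤ s := le_trans (le_min hc hd) hs.1
      exact (ContinuousAt.rpow_const (by fun_prop)
        (Or.inl (by linarith))).continuousWithinAt
  rw [← intervalIntegral.integral_add_adjacent_intervals (hint 0 x le_rfl hx.le)
    (hint x 1 hx.le zero_le_one)]
  have h1 : ∫ u in (0 : ℝ)..x, u ^ (κ - 1) * (x + u) ^ (-b) ≤ 1 / κ * x ^ (κ - b) := by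
    calc _ ≤ ∫ u in (0 : ℝ)..x, u ^ (κ - 1) * x ^ (-b) := by
          refine intervalIntegral.integral_mono_on_of_le_Ioo hx.le (hint 0 x le_rfl hx.le)
            ((intervalIntegral.intervalIntegrable_rpow' (by linarith)).mul_const _) ?_
          intro u hu
          exact mul_le_mul_of_nonneg_left
            (Real.rpow_le_rpow_of_nonpos hx (by linarith [hu.1]) (by linarith))
            (Real.rpow_nonneg hu.1.le _)
      _ = 1 / κ * x ^ (κ - b) := by
          rw [intervalIntegral.integral_mul_const, integral_rpow (Or.inl (by linarith)),
            sub_add_cancel, Real.zero_rpow hκ.ne', sub_zero, sub_eq_add_neg κ b,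
            Real.rpow_add hx]
          ring
  have h2 : ∫ u in x..1, u ^ (κ - 1) * (x + u) ^ (-b) ≤ 1 / (b - κ) * x ^ (κ - b) := by
    have h0 : (0 : ℝ) ∉ Set.uIcc x 1 := by
      rw [Set.uIcc_of_le hx1]; exact fun h => absurd h.1 (by linarith)
    calc _ ≤ ∫ u in x..1, u ^ (κ - b - 1) := by
          refine intervalIntegral.integral_mono_on_of_le_Ioo hx1 (hint x 1 hx.le zero_le_one)
            (intervalIntegral.intervalIntegrable_rpow (Or.inr h0)) ?_
          intro u hu
          have hu0 : 0 < u := hx.trans hu.1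
          rw [show κ - b - 1 = (κ - 1) + -b by ring, Real.rpow_add hu0]
          exact mul_le_mul_of_nonneg_left
            (Real.rpow_le_rpow_of_nonpos hu0 (by linarith) (by linarith))
            (Real.rpow_nonneg hu0.le _)
      _ = (1 - x ^ (κ - b)) / (κ - b) := by
          rw [integral_rpow (Or.inr ⟨by intro h; linarith, h0⟩), sub_add_cancel, Real.one_rpow]
      _ ≤ _ := by
          have : 0 < b - κ := by linarith
          rw [show (1 - x ^ (κ - b)) / (κ - b) = 1 / (b - κ) * (x ^ (κ - b) - 1) by
            rw [show κ - b = -(b - κ) by ring]; field_simp; ring]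
          exact mul_le_mul_of_nonneg_left (by linarith) (by positivity)
  linarith

theorem exists_integral_jacobi_mul_rpow_neg_le {α κ b : ℝ} (hα : 0 < α) (hκ : 0 < κ)
    (hb : κ < b) :
    ∃ C : ℝ, 0 < C ∧ ∀ x : ℝ, 0 < x → x ≤ 1 →
      ∫ s in (0 : ℝ)..1, s ^ (α - 1) * (1 - s) ^ (κ - 1) * (x + (1 - s)) ^ (-b)
        ≤ C * x ^ (κ - b) := by
  set W := ∫ s in (0 : ℝ)..1, s ^ (α - 1) * (1 - s) ^ (κ - 1) with hW
  have hW0 : 0 ≤ W := intervalIntegral.integral_nonneg zero_le_one fun s hs =>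
    mul_nonneg (Real.rpow_nonneg hs.1 _) (Real.rpow_nonneg (by linarith [hs.2]) _)
  set D : ℝ := (1 / 2 : ℝ) ^ (α - 1) + 1 with hD
  have hD0 : 0 < D := by positivity
  have hbk : 0 < b - κ := by linarith
  refine ⟨D * (1 / κ + 1 / (b - κ)) + (1 / 2 : ℝ) ^ (-b) * W, by positivity, ?_⟩
  intro x hx hx1
  have hint1 : IntervalIntegrable
      (fun s : ℝ => (1 - s) ^ (κ - 1) * (x + (1 - s)) ^ (-b)) volume 0 1 := by
    have := intervalIntegrable_jacobi_mul (α := 1) one_pos hκ (g := fun s => x + (1 - s)) (-b)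
      (by fun_prop) (fun s hs => by linarith [hs.2])
    simpa using this
  have hsub : ∫ s in (0 : ℝ)..1, (1 - s) ^ (κ - 1) * (x + (1 - s)) ^ (-b)
      = ∫ u in (0 : ℝ)..1, u ^ (κ - 1) * (x + u) ^ (-b) := by
    have := intervalIntegral.integral_comp_sub_left (a := 0) (b := 1)
      (fun u : ℝ => u ^ (κ - 1) * (x + u) ^ (-b)) 1
    simpa using this
  have hx2 : 1 ≤ x ^ (κ - b) :=
    Real.one_le_rpow_of_pos_of_le_one_of_nonpos hx hx1 (by linarith)
  calc _ ≤ ∫ s in (0 : ℝ)..1, (D * ((1 - s) ^ (κ - 1) * (x + (1 - s)) ^ (-b))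
            + (1 / 2 : ℝ) ^ (-b) * (s ^ (α - 1) * (1 - s) ^ (κ - 1))) := by
        refine intervalIntegral.integral_mono_on_of_le_Ioo zero_le_one
          (intervalIntegrable_jacobi_mul hα hκ (g := fun s => x + (1 - s)) (-b)
            (by fun_prop) (fun s hs => by linarith [hs.2]))
          ((hint1.const_mul _).add
            ((intervalIntegrable_rpow_mul_one_sub_rpow hα hκ).const_mul _)) ?_
        intro s hs
        have p1 : 0 ≤ s ^ (α - 1) := Real.rpow_nonneg hs.1.le _
        have p2 : 0 ≤ (1 - s) ^ (κ - 1) := Real.rpow_nonneg (by linarith [hs.2]) _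
        have p3 : 0 ≤ (x + (1 - s)) ^ (-b) := Real.rpow_nonneg (by linarith [hs.2]) _
        have p4 : 0 ≤ (1 / 2 : ℝ) ^ (-b) := by positivity
        rcases le_total s (1 / 2) with h | h
        · have : (x + (1 - s)) ^ (-b) ≤ (1 / 2 : ℝ) ^ (-b) :=
            Real.rpow_le_rpow_of_nonpos (by norm_num) (by linarith) (by linarith)
          have h1 := mul_le_mul_of_nonneg_left this (mul_nonneg p1 p2)
          have h2 : 0 ≤ D * ((1 - s) ^ (κ - 1) * (x + (1 - s)) ^ (-b)) := by positivity
          linarith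
        · have : s ^ (α - 1) ≤ D := by
            rcases le_total 0 (α - 1) with h' | h'
            · have := Real.rpow_le_one hs.1.le hs.2.le h'
              have : 0 ≤ (1 / 2 : ℝ) ^ (α - 1) := by positivity
              linarith
            · have := Real.rpow_le_rpow_of_nonpos (by norm_num) h h'
              linarith
          have h1 := mul_le_mul_of_nonneg_right this (mul_nonneg p2 p3)
          have h2 : 0 ≤ (1 / 2 : ℝ) ^ (-b) * (s ^ (α - 1) * (1 - s) ^ (κ - 1)) := by positivity
          linarith
    _ = D * (∫ u in (0 : ℝ)..1, u ^ (κ - 1) * (x + u) ^ (-b)) + (1 / 2 : ℝ) ^ (-b) * W := by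
        rw [intervalIntegral.integral_add (hint1.const_mul _)
          ((intervalIntegrable_rpow_mul_one_sub_rpow hα hκ).const_mul _),
          intervalIntegral.integral_const_mul, intervalIntegral.integral_const_mul, hsub]
    _ ≤ D * ((1 / κ + 1 / (b - κ)) * x ^ (κ - b)) + (1 / 2 : ℝ) ^ (-b) * W * x ^ (κ - b) := by
        refine add_le_add (mul_le_mul_of_nonneg_left
          (integral_rpow_mul_add_rpow_neg_le hκ hb hx hx1) hD0.le) ?_
        exact le_mul_of_one_le_right (by positivity) hx2
    _ = _ := by ring

/-- The Euler-type integral `∫₀¹ s^(α-1) (1-s)^(κ-1) (L + r - 2rs)^(-b) ds`. -/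
noncomputable def eulerInt (α κ b L r : ℝ) : ℝ :=
  ∫ s in (0 : ℝ)..1, s ^ (α - 1) * (1 - s) ^ (κ - 1) * (L + r - 2 * r * s) ^ (-b)

theorem sub_le_eulerInt_base {L r s : ℝ} (hr : 0 ≤ r) (hs : s ≤ 1) :
    L - r ≤ L + r - 2 * r * s := by nlinarith

theorem eulerInt_base_le {L r s : ℝ} (hr : 0 ≤ r) (hrL : r < L) (hs : 0 ≤ s) :
    L + r - 2 * r * s ≤ 2 * L := by nlinarith [mul_nonneg hr hs]

theorem intervalIntegrable_eulerInt {α κ L r : ℝ} (hα : 0 < α) (hκ : 0 < κ) (b : ℝ)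
    (hr : 0 ≤ r) (hrL : r < L) :
    IntervalIntegrable (fun s : ℝ => s ^ (α - 1) * (1 - s) ^ (κ - 1) *
      (L + r - 2 * r * s) ^ (-b)) volume 0 1 :=
  intervalIntegrable_jacobi_mul hα hκ (g := fun s => L + r - 2 * r * s) (-b) (by fun_prop)
    fun _ hs => (sub_pos.2 hrL).trans_le (sub_le_eulerInt_base hr hs.2)

theorem eulerInt_nonneg {α κ b L r : ℝ} (hr : 0 ≤ r) (hrL : r < L) :
    0 ≤ eulerInt α κ b L r :=
  intervalIntegral.integral_nonneg zero_le_one fun s hs =>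
    mul_nonneg (mul_nonneg (Real.rpow_nonneg hs.1 _) (Real.rpow_nonneg (by linarith [hs.2]) _))
      (Real.rpow_nonneg (by linarith [sub_le_eulerInt_base (L := L) hr hs.2]) _)

theorem exists_eulerInt_le {α κ b : ℝ} (hα : 0 < α) (hκ : 0 < κ) (hb : κ < b) :
    ∃ C : ℝ, 0 < C ∧ ∀ L r : ℝ, 0 ≤ r → r < L →
      eulerInt α κ b L r ≤ C * (L ^ (-κ) * (L - r) ^ (κ - b)) := by
  obtain ⟨C, hC, h⟩ := exists_integral_jacobi_mul_rpow_neg_le hα hκ hb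
  refine ⟨(1 / 2 : ℝ) ^ (-b) * C, by positivity, ?_⟩
  intro L r hr hrL
  have hL : 0 < L := hr.trans_lt hrL
  have ha : 0 < L - r := by linarith
  set x := (L - r) / L with hx
  have hx0 : 0 < x := by positivity
  have hx1 : x ≤ 1 := by rw [hx, div_le_one hL]; linarith
  have hxL : L * x = L - r := by rw [hx]; field_simp
  calc eulerInt α κ b L r ≤ ∫ s in (0 : ℝ)..1, (L / 2) ^ (-b) *
          (s ^ (α - 1) * (1 - s) ^ (κ - 1) * (x + (1 - s)) ^ (-b)) := by
        refine intervalIntegral.integral_mono_on_of_le_Ioo zero_le_one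
          (intervalIntegrable_eulerInt hα hκ b hr hrL)
          ((intervalIntegrable_jacobi_mul hα hκ (g := fun s => x + (1 - s)) (-b)
            (by fun_prop) (fun s hs => by linarith [hs.2])).const_mul _) ?_
        intro s hs
        have p1 : 0 ≤ s ^ (α - 1) * (1 - s) ^ (κ - 1) :=
          mul_nonneg (Real.rpow_nonneg hs.1.le _) (Real.rpow_nonneg (by linarith [hs.2]) _)
        have hx' : 0 < x + (1 - s) := by linarith [hs.2]
        have hle : L / 2 * (x + (1 - s)) ≤ L + r - 2 * r * s := by
          have e : L / 2 * (x + (1 - s)) = (L - r) / 2 + L * (1 - s) / 2 := by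
            rw [← hxL]; ring
          rw [e]
          nlinarith [mul_nonneg hr (sub_nonneg.2 hs.2.le), mul_nonneg hr hs.1.le,
            mul_nonneg ha.le hs.1.le, mul_nonneg ha.le (sub_nonneg.2 hs.2.le)]
        have h1 := Real.rpow_le_rpow_of_nonpos (by positivity) hle
          (show -b ≤ 0 by linarith)
        rw [Real.mul_rpow (by positivity) hx'.le] at h1
        have h2 := mul_le_mul_of_nonneg_left h1 p1
        linarith
    _ = (L / 2) ^ (-b) * ∫ s in (0 : ℝ)..1,
          (s ^ (α - 1) * (1 - s) ^ (κ - 1) * (x + (1 - s)) ^ (-b)) := by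
        rw [intervalIntegral.integral_const_mul]
    _ ≤ (L / 2) ^ (-b) * (C * x ^ (κ - b)) :=
        mul_le_mul_of_nonneg_left (h x hx0 hx1) (by positivity)
    _ = _ := by
        have e : L ^ (-κ) = L ^ (-b) * (L ^ (κ - b))⁻¹ := by
          rw [← Real.rpow_neg hL.le, ← Real.rpow_add hL]; congr 1; ring
        rw [hx, Real.div_rpow ha.le hL.le, div_eq_mul_one_div L 2,
          Real.mul_rpow hL.le (by norm_num), e]
        ring

theorem exists_le_eulerInt {α κ : ℝ} (hα : 0 < α) (hκ : 0 < κ) (b : ℝ) :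
    ∃ c : ℝ, 0 < c ∧ ∀ L r : ℝ, 0 ≤ r → r < L → c * L ^ (-b) ≤ eulerInt α κ b L r := by
  have hpos : ∀ s ∈ Set.Ioo (0 : ℝ) 1, ∀ κ' : ℝ, 0 < s ^ (α - 1) * (1 - s) ^ (κ' - 1) :=
    fun s hs κ' => mul_pos (Real.rpow_pos_of_pos hs.1 _)
      (Real.rpow_pos_of_pos (by linarith [hs.2]) _)
  rcases le_total 0 b with hb | hb
  · refine ⟨2 ^ (-b) * ∫ s in (0 : ℝ)..1, s ^ (α - 1) * (1 - s) ^ (κ - 1), mul_pos (by positivity)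
      (intervalIntegral.intervalIntegral_pos_of_pos_on
        (intervalIntegrable_rpow_mul_one_sub_rpow hα hκ) (fun s hs => hpos s hs κ) one_pos), ?_⟩
    intro L r hr hrL
    have hL : 0 < L := hr.trans_lt hrL
    rw [mul_right_comm, ← Real.mul_rpow zero_le_two hL.le,
      ← intervalIntegral.integral_const_mul]
    refine intervalIntegral.integral_mono_on_of_le_Ioo zero_le_one
      ((intervalIntegrable_rpow_mul_one_sub_rpow hα hκ).const_mul _)
      (intervalIntegrable_eulerInt hα hκ b hr hrL) ?_
    intro s hs
    have h1 := Real.rpow_le_rpow_of_nonpos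
      ((sub_pos.2 hrL).trans_le (sub_le_eulerInt_base hr hs.2.le))
      (eulerInt_base_le hr hrL hs.1.le) (show -b ≤ 0 by linarith)
    rw [mul_comm]
    exact mul_le_mul_of_nonneg_left h1 (hpos s hs κ).le
  · have hκb : 0 < κ - b := by linarith
    refine ⟨∫ s in (0 : ℝ)..1, s ^ (α - 1) * (1 - s) ^ (κ - b - 1),
      (intervalIntegral.intervalIntegral_pos_of_pos_on
        (intervalIntegrable_rpow_mul_one_sub_rpow hα hκb) (fun s hs => hpos s hs _) one_pos), ?_⟩
    intro L r hr hrL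
    have hL : 0 < L := hr.trans_lt hrL
    rw [← intervalIntegral.integral_mul_const]
    refine intervalIntegral.integral_mono_on_of_le_Ioo zero_le_one
      ((intervalIntegrable_rpow_mul_one_sub_rpow hα hκb).mul_const _)
      (intervalIntegrable_eulerInt hα hκ b hr hrL) ?_
    intro s hs
    have hs1 : 0 < 1 - s := by linarith [hs.2]
    have h1 := Real.rpow_le_rpow (by positivity)
      (show (1 - s) * L ≤ L + r - 2 * r * s by
        nlinarith [mul_nonneg hr hs1.le, mul_nonneg (sub_nonneg.2 hrL.le) hs.1.le])
      (show 0 ≤ -b by linarith)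
    rw [Real.mul_rpow hs1.le hL.le] at h1
    rw [show κ - b - 1 = (κ - 1) + -b by ring, Real.rpow_add hs1]
    calc _ = s ^ (α - 1) * (1 - s) ^ (κ - 1) * ((1 - s) ^ (-b) * L ^ (-b)) := by ring
      _ ≤ _ := mul_le_mul_of_nonneg_left h1 (hpos s hs κ).le

theorem eulerInt_le_mul_eulerInt_add_one {α κ L r : ℝ} (hα : 0 < α) (hκ : 0 < κ) (b : ℝ)
    (hr : 0 ≤ r) (hrL : r < L) :
    eulerInt α κ b L r ≤ 2 * L * eulerInt α κ (b + 1) L r := by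
  unfold eulerInt
  rw [← intervalIntegral.integral_const_mul]
  refine intervalIntegral.integral_mono_on_of_le_Ioo zero_le_one
    (intervalIntegrable_eulerInt hα hκ b hr hrL)
    ((intervalIntegrable_eulerInt hα hκ (b + 1) hr hrL).const_mul _) ?_
  intro s hs
  have hbase := (sub_pos.2 hrL).trans_le (sub_le_eulerInt_base hr hs.2.le)
  have hle := eulerInt_base_le hr hrL hs.1.le
  have hw : 0 ≤ s ^ (α - 1) * (1 - s) ^ (κ - 1) :=
    mul_nonneg (Real.rpow_nonneg hs.1.le _) (Real.rpow_nonneg (by linarith [hs.2]) _)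
  have e : (L + r - 2 * r * s) ^ (-b)
      = (L + r - 2 * r * s) * (L + r - 2 * r * s) ^ (-(b + 1)) := by
    rw [show -b = 1 + -(b + 1) by ring, Real.rpow_add hbase, Real.rpow_one]
  rw [e]
  have := mul_le_mul_of_nonneg_left
    (mul_le_mul_of_nonneg_right hle (Real.rpow_nonneg hbase.le (-(b + 1)))) hw
  linarith

theorem hasDerivAt_eulerInt {α κ L r : ℝ} (hα : 0 < α) (hκ : 0 < κ) (b : ℝ)
    (hr : 0 ≤ r) (hrL : r < L) :
    HasDerivAt (fun L' => eulerInt α κ b L' r) (-b * eulerInt α κ (b + 1) L r) L := by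
  have hL : 0 < L := hr.trans_lt hrL
  set δ := (L - r) / 2 with hδ
  have hδ0 : 0 < δ := by rw [hδ]; linarith
  set N : Set ℝ := Set.Ioo (r + δ) (2 * L)
  have hN : N ∈ nhds L := Ioo_mem_nhds (by rw [hδ]; linarith) (by linarith)
  set K : ℝ := δ ^ (-(b + 1)) + (4 * L) ^ (-(b + 1))
  have hmem : ∀ L' ∈ N, r < L' := fun L' h => by linarith [h.1]
  have hder := intervalIntegral.hasDerivAt_integral_of_dominated_loc_of_deriv_le
    (μ := volume) (a := 0) (b := 1)
    (F := fun L' s : ℝ => s ^ (α - 1) * (1 - s) ^ (κ - 1) * (L' + r - 2 * r * s) ^ (-b))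
    (F' := fun L' s : ℝ => -b * (s ^ (α - 1) * (1 - s) ^ (κ - 1) *
      (L' + r - 2 * r * s) ^ (-(b + 1))))
    (bound := fun s => |b| * K * (s ^ (α - 1) * (1 - s) ^ (κ - 1)))
    hN ?_ (intervalIntegrable_eulerInt hα hκ b hr hrL) ?_ ?_
    ((intervalIntegrable_rpow_mul_one_sub_rpow hα hκ).const_mul _) ?_
  · have h2 := hder.2
    rw [intervalIntegral.integral_const_mul] at h2
    exact h2
  · filter_upwards [hN] with L' hL'
    exact (intervalIntegrable_eulerInt hα hκ b hr (hmem L' hL')).aestronglyMeasurable_restrict_uIoc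
  · exact ((intervalIntegrable_eulerInt hα hκ (b + 1) hr hrL).const_mul
      (-b)).aestronglyMeasurable_restrict_uIoc
  · refine Filter.Eventually.of_forall fun s hs L' hL' => ?_
    rw [Set.uIoc_of_le zero_le_one] at hs
    have hw : 0 ≤ s ^ (α - 1) * (1 - s) ^ (κ - 1) :=
      mul_nonneg (Real.rpow_nonneg hs.1.le _) (Real.rpow_nonneg (by linarith [hs.2]) _)
    have hb1 : δ ≤ L' + r - 2 * r * s := by
      linarith [sub_le_eulerInt_base (L := L') hr hs.2, hL'.1]
    have hb2 : L' + r - 2 * r * s ≤ 4 * L := by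
      linarith [eulerInt_base_le hr (hmem L' hL') hs.1.le, hL'.2]
    have hp : 0 < L' + r - 2 * r * s := hδ0.trans_le hb1
    have hK : (L' + r - 2 * r * s) ^ (-(b + 1)) ≤ K := by
      rcases le_total 0 (-(b + 1)) with h | h
      · have := Real.rpow_le_rpow hp.le hb2 h
        have : 0 < δ ^ (-(b + 1)) := by positivity
        simp only [K]; linarith
      · have := Real.rpow_le_rpow_of_nonpos hδ0 hb1 h
        have : 0 < (4 * L) ^ (-(b + 1)) := by positivity
        simp only [K]; linarith
    rw [Real.norm_eq_abs, abs_mul, abs_neg,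
      abs_of_nonneg (mul_nonneg hw (Real.rpow_nonneg hp.le _))]
    have := mul_le_mul_of_nonneg_left (mul_le_mul_of_nonneg_left hK hw) (abs_nonneg b)
    linarith
  · refine Filter.Eventually.of_forall fun s hs L' hL' => ?_
    rw [Set.uIoc_of_le zero_le_one] at hs
    have hp : 0 < L' + r - 2 * r * s :=
      (sub_pos.2 (hmem L' hL')).trans_le (sub_le_eulerInt_base hr hs.2)
    have h0 : HasDerivAt (fun y : ℝ => y + r - 2 * r * s) 1 L' :=
      ((hasDerivAt_id L').add_const r).sub_const _
    have h1 := (h0.rpow_const (p := -b) (Or.inl hp.ne')).const_mul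
      (s ^ (α - 1) * (1 - s) ^ (κ - 1))
    refine h1.congr_deriv ?_
    rw [show -(b + 1) = -b - 1 by ring]
    ring

theorem Psi_eq_eulerInt (n : ℕ) {α γ ρ b lam t : ℝ} {x : EuclideanSpace ℝ (Fin n)}
    (h : ‖x‖ < t + lam) :
    Psi n α γ ρ b lam t x = Real.Gamma γ / (Real.Gamma α * Real.Gamma (γ - α)) *
      (‖x‖ ^ ρ * eulerInt α (γ - α) b (t + lam) ‖x‖) := by
  have hr : 0 ≤ ‖x‖ := norm_nonneg x
  have hD : 0 < t + ‖x‖ + lam := by linarith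
  have key : (t + ‖x‖ + lam) ^ (-b) * (∫ s in (0 : ℝ)..1, s ^ (α - 1) * (1 - s) ^ (γ - α - 1) *
      (1 - 2 * ‖x‖ / (t + ‖x‖ + lam) * s) ^ (-b)) = eulerInt α (γ - α) b (t + lam) ‖x‖ := by
    unfold eulerInt
    rw [← intervalIntegral.integral_const_mul]
    refine intervalIntegral.integral_congr fun s hs => ?_
    rw [Set.uIcc_of_le zero_le_one] at hs
    have hb := (sub_pos.2 h).trans_le (sub_le_eulerInt_base hr hs.2)
    have e : t + lam + ‖x‖ - 2 * ‖x‖ * s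
        = (t + ‖x‖ + lam) * (1 - 2 * ‖x‖ / (t + ‖x‖ + lam) * s) := by
      field_simp; ring
    have hpos : 0 < 1 - 2 * ‖x‖ / (t + ‖x‖ + lam) * s :=
      pos_of_mul_pos_right (e ▸ hb) hD.le
    rw [e, Real.mul_rpow hD.le hpos.le]
    ring
  unfold Psi hyperF
  rw [← key]
  ring

theorem deriv_Psi (n : ℕ) {α γ ρ lam t : ℝ} {x : EuclideanSpace ℝ (Fin n)} (b : ℝ)
    (hα : 0 < α) (hγ : α < γ) (h : ‖x‖ < t + lam) :
    deriv (fun t' => Psi n α γ ρ b lam t' x) t = -b * Psi n α γ ρ (b + 1) lam t x := by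
  have hloc : (fun t' => Psi n α γ ρ b lam t' x) =ᶠ[nhds t] fun t' =>
      Real.Gamma γ / (Real.Gamma α * Real.Gamma (γ - α)) *
      (‖x‖ ^ ρ * eulerInt α (γ - α) b (t' + lam) ‖x‖) := by
    filter_upwards [Ioi_mem_nhds (show ‖x‖ - lam < t by linarith)] with t' ht'
    exact Psi_eq_eulerInt n (by linarith [Set.mem_Ioi.1 ht'])
  rw [hloc.deriv_eq, Psi_eq_eulerInt n h]
  have hd := (hasDerivAt_eulerInt hα (sub_pos.2 hγ) b (norm_nonneg x) h).comp_add_const t lam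
  rw [((hd.const_mul _).const_mul _).deriv]
  ring

theorem rpow_le_abs_rpow_mul_rpow {K x y : ℝ} (e : ℝ) (hx : 0 < x) (hy : 0 < y)
    (hxy : x ≤ K * y) (hyx : y ≤ K * x) : x ^ e ≤ K ^ |e| * y ^ e := by
  have hK : 0 < K := pos_of_mul_pos_left (hx.trans_le hxy) hy.le
  rcases le_total 0 e with he | he
  · rw [abs_of_nonneg he, ← Real.mul_rpow hK.le hy.le]
    exact Real.rpow_le_rpow hx.le hxy he
  · have h1 := Real.rpow_le_rpow_of_nonpos hy hyx he
    rw [Real.mul_rpow hK.le hx.le] at h1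
    rw [abs_of_nonpos he, Real.rpow_neg hK.le, inv_mul_eq_div, le_div_iff₀ (by positivity)]
    linarith

theorem exists_rpow_mul_sub_rpow_neg_le {q : ℝ} (σ : ℝ) (hq : 0 < q) :
    ∃ D : ℝ, 0 < D ∧ ∀ L r : ℝ, 0 < r → r < L →
      r ^ (σ - 1) * (L - r) ^ (-q)
        ≤ D * (L ^ (-q) * r ^ (σ - 1) + L ^ (σ - 1) * (L - r) ^ (-q)) := by
  refine ⟨2 ^ q + 2 ^ |σ - 1|, by positivity, ?_⟩
  intro L r hr hrL
  have hL : 0 < L := hr.trans hrL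
  have ha : 0 < L - r := by linarith
  have p1 : 0 < r ^ (σ - 1) := by positivity
  have p2 : 0 < (L - r) ^ (-q) := by positivity
  have p3 : 0 < L ^ (-q) := by positivity
  have p4 : 0 < L ^ (σ - 1) := by positivity
  have p5 : (0 : ℝ) < 2 ^ q := by positivity
  have p6 : (0 : ℝ) < 2 ^ |σ - 1| := by positivity
  rcases le_total r (L / 2) with h | h
  · have h1 : (L - r) ^ (-q) ≤ (2 : ℝ) ^ q * L ^ (-q) := by
      have := Real.rpow_le_rpow_of_nonpos (by positivity) (show L / 2 ≤ L - r by linarith)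
        (show -q ≤ 0 by linarith)
      rw [Real.div_rpow hL.le zero_le_two, Real.rpow_neg zero_le_two q, div_inv_eq_mul] at this
      linarith
    have h2 := mul_le_mul_of_nonneg_left h1 p1.le
    nlinarith [mul_pos p6 (mul_pos p3 p1), mul_pos p5 (mul_pos p4 p2), mul_pos p6 (mul_pos p4 p2)]
  · have h1 := rpow_le_abs_rpow_mul_rpow (K := 2) (σ - 1) hr hL (by linarith) (by linarith)
    have h2 := mul_le_mul_of_nonneg_right h1 p2.le
    nlinarith [mul_pos p6 (mul_pos p3 p1), mul_pos p5 (mul_pos p4 p2), mul_pos p5 (mul_pos p3 p1)]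

theorem integral_rpow_add_sub_rpow_neg_le {σ q R L : ℝ} (hσ : 0 < σ) (hq : 1 < q) (hR : 0 < R)
    (hRL : R < L) (hL1 : 1 ≤ L) :
    IntervalIntegrable (fun r : ℝ => L ^ (-q) * r ^ (σ - 1) + L ^ (σ - 1) * (L - r) ^ (-q))
        volume 0 R ∧
      ∫ r in (0 : ℝ)..R, (L ^ (-q) * r ^ (σ - 1) + L ^ (σ - 1) * (L - r) ^ (-q))
        ≤ (1 / σ + (L - R) ^ (1 - q) / (q - 1)) * L ^ (σ - 1) := by
  have hL : 0 < L := by linarith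
  have i1 : IntervalIntegrable (fun r : ℝ => r ^ (σ - 1)) volume 0 R :=
    intervalIntegral.intervalIntegrable_rpow' (by linarith)
  have i2 : IntervalIntegrable (fun r : ℝ => (L - r) ^ (-q)) volume 0 R := by
    apply ContinuousOn.intervalIntegrable
    intro r hr
    rw [Set.uIcc_of_le hR.le] at hr
    exact (ContinuousAt.rpow_const (by fun_prop)
      (Or.inl (by linarith [hr.2]))).continuousWithinAt
  refine ⟨(i1.const_mul _).add (i2.const_mul _), ?_⟩
  rw [intervalIntegral.integral_add (i1.const_mul _) (i2.const_mul _),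
    intervalIntegral.integral_const_mul, intervalIntegral.integral_const_mul,
    integral_rpow (Or.inl (by linarith)), sub_add_cancel, Real.zero_rpow hσ.ne', sub_zero,
    intervalIntegral.integral_comp_sub_left (fun v : ℝ => v ^ (-q)) L, sub_zero]
  have h0 : (0 : ℝ) ∉ Set.uIcc (L - R) L := by
    rw [Set.uIcc_of_le (by linarith)]; exact fun h => absurd h.1 (by linarith)
  rw [integral_rpow (Or.inr ⟨by intro h; linarith, h0⟩)]
  have h1 : L ^ (-q) * (R ^ σ / σ) ≤ 1 / σ * L ^ (σ - 1) := by
    have a1 : R ^ σ ≤ L ^ σ := Real.rpow_le_rpow hR.le hRL.le hσ.le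
    have a2 : L ^ (-q) * L ^ σ ≤ L ^ (σ - 1) := by
      rw [← Real.rpow_add hL]
      exact Real.rpow_le_rpow_of_exponent_le hL1 (by linarith)
    have a3 : L ^ (-q) * R ^ σ ≤ L ^ (σ - 1) :=
      (mul_le_mul_of_nonneg_left a1 (by positivity)).trans a2
    calc _ = 1 / σ * (L ^ (-q) * R ^ σ) := by ring
      _ ≤ _ := mul_le_mul_of_nonneg_left a3 (by positivity)
  have h2 : (L ^ (-q + 1) - (L - R) ^ (-q + 1)) / (-q + 1)
      ≤ (L - R) ^ (1 - q) / (q - 1) := by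
    have hq1 : 0 < q - 1 := by linarith
    have hp : 0 < L ^ (1 - q) := by positivity
    rw [show -q + 1 = -(q - 1) by ring, div_neg, ← neg_div, show -(q - 1) = 1 - q by ring]
    exact div_le_div_of_nonneg_right (by linarith) hq1.le
  have h3 := mul_le_mul_of_nonneg_left h2 (show 0 ≤ L ^ (σ - 1) by positivity)
  linarith

theorem exists_integral_ball_le {n : ℕ} (hn : 1 ≤ n) {σ q lam : ℝ} (hσ : 0 < σ) (hq : 1 < q)
    (hlam : 1 < lam) :
    ∃ C : ℝ, 0 < C ∧ ∀ (t M : ℝ) (f : EuclideanSpace ℝ (Fin n) → ℝ), 0 < t → 0 ≤ M →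
      (∀ x, 0 < ‖x‖ → ‖x‖ < 1 + t → 0 ≤ f x ∧
        f x ≤ M * (‖x‖ ^ (σ - n) * (t + lam - ‖x‖) ^ (-q))) →
      0 ≤ ∫ x in Metric.ball (0 : EuclideanSpace ℝ (Fin n)) (1 + t), f x ∧
      ∫ x in Metric.ball (0 : EuclideanSpace ℝ (Fin n)) (1 + t), f x
        ≤ C * M * (t + lam) ^ (σ - 1) := by
  have : Nonempty (Fin n) := ⟨⟨0, hn⟩⟩
  obtain ⟨D, hD, hDb⟩ := exists_rpow_mul_sub_rpow_neg_le σ (zero_lt_one.trans hq)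
  set V : ℝ := (volume : Measure (EuclideanSpace ℝ (Fin n))).real (Metric.ball 0 1) with hV
  have hV0 : 0 ≤ V := measureReal_nonneg
  set Q : ℝ := 1 / σ + (lam - 1) ^ (1 - q) / (q - 1) with hQ
  have hQ0 : 0 ≤ Q := by
    have : 0 ≤ (lam - 1) ^ (1 - q) := Real.rpow_nonneg (by linarith) _
    have : 0 < q - 1 := by linarith
    positivity
  refine ⟨n * V * (D * Q) + 1, by positivity, ?_⟩
  intro t M f ht hM hf
  set R := 1 + t with hR
  set L := t + lam with hL
  have hR0 : 0 < R := by linarith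
  have hRL : R < L := by linarith
  have hL0 : 0 < L := by linarith
  have hae : ∀ᵐ x ∂((volume : Measure (EuclideanSpace ℝ (Fin n))).restrict (Metric.ball 0 R)),
      0 < ‖x‖ ∧ ‖x‖ < R := by
    have h1 : ∀ᵐ x ∂((volume : Measure (EuclideanSpace ℝ (Fin n))).restrict (Metric.ball 0 R)),
        x ≠ 0 := ae_restrict_of_ae (Measure.ae_ne volume 0)
    filter_upwards [h1, ae_restrict_mem Metric.isOpen_ball.measurableSet] with x hx hx'
    exact ⟨norm_pos_iff.2 hx, by simpa using hx'⟩
  have hnn : 0 ≤ᵐ[volume.restrict (Metric.ball (0 : EuclideanSpace ℝ (Fin n)) R)] f := by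
    filter_upwards [hae] with x hx using (hf x hx.1 hx.2).1
  refine ⟨integral_nonneg_of_ae hnn, ?_⟩
  set h : ℝ → ℝ := fun r => L ^ (-q) * r ^ (σ - 1) + L ^ (σ - 1) * (L - r) ^ (-q) with hh
  obtain ⟨hi, hle⟩ := integral_rpow_add_sub_rpow_neg_le hσ hq hR0 hRL (by linarith)
  rw [show L - R = lam - 1 by rw [hL, hR]; ring] at hle
  set g : ℝ → ℝ := (Set.Iio R).indicator fun r => r ^ (1 - (n : ℝ)) * (M * (D * h r)) with hg
  have hgeq : Set.EqOn (fun y : ℝ => y ^ (Module.finrank ℝ (EuclideanSpace ℝ (Fin n)) - 1) • g y)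
      ((Set.Iio R).indicator fun r => M * (D * h r)) (Set.Ioi 0) := by
    intro y hy
    have hy0 : (0 : ℝ) < y := hy
    have e : y ^ (n - 1) * y ^ (1 - (n : ℝ)) = 1 := by
      rw [← Real.rpow_natCast, ← Real.rpow_add hy0, Nat.cast_sub hn]
      simp
    by_cases hyR : y < R
    · simp only [hg, finrank_euclideanSpace, Fintype.card_fin, smul_eq_mul]
      rw [Set.indicator_of_mem (Set.mem_Iio.2 hyR), Set.indicator_of_mem (Set.mem_Iio.2 hyR),
        ← mul_assoc, e, one_mul]
    · simp [hg, hyR]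
  have hint0 : IntegrableOn (fun r => M * (D * h r)) (Set.Ioi 0 ∩ Set.Iio R) := by
    rw [Set.Ioi_inter_Iio]
    exact (((intervalIntegrable_iff_integrableOn_Ioo_of_le hR0.le).1 hi).const_mul D).const_mul M
  have hgint : Integrable (fun x : EuclideanSpace ℝ (Fin n) => g ‖x‖) := by
    rw [integrable_fun_norm_addHaar]
    rw [integrableOn_congr_fun hgeq measurableSet_Ioi, IntegrableOn,
      integrable_indicator_iff measurableSet_Iio, IntegrableOn,
      Measure.restrict_restrict measurableSet_Iio, Set.inter_comm]
    exact hint0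
  have hgnn : ∀ x : EuclideanSpace ℝ (Fin n), 0 ≤ g ‖x‖ := by
    intro x
    have hx := norm_nonneg x
    by_cases hxR : ‖x‖ < R
    · have p1 : 0 ≤ ‖x‖ ^ (σ - 1) := Real.rpow_nonneg hx _
      have p2 : 0 ≤ (L - ‖x‖) ^ (-q) := Real.rpow_nonneg (by linarith) _
      have p3 : 0 ≤ ‖x‖ ^ (1 - (n : ℝ)) := Real.rpow_nonneg hx _
      simp only [hg, hh]
      rw [Set.indicator_of_mem (Set.mem_Iio.2 hxR)]
      positivity
    · simp [hg, hxR]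
  calc ∫ x in Metric.ball (0 : EuclideanSpace ℝ (Fin n)) R, f x
      ≤ ∫ x in Metric.ball (0 : EuclideanSpace ℝ (Fin n)) R, g ‖x‖ := by
        refine integral_mono_of_nonneg hnn hgint.integrableOn ?_
        filter_upwards [hae] with x hx
        refine (hf x hx.1 hx.2).2.trans ?_
        simp only [hg]
        rw [Set.indicator_of_mem (Set.mem_Iio.2 hx.2),
          mul_left_comm (‖x‖ ^ (1 - (n : ℝ))) M (D * h ‖x‖)]
        refine mul_le_mul_of_nonneg_left ?_ hM
        have := mul_le_mul_of_nonneg_left (hDb L ‖x‖ hx.1 (hx.2.trans hRL))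
          (Real.rpow_nonneg hx.1.le (1 - (n : ℝ)))
        rw [← mul_assoc, ← Real.rpow_add hx.1,
          show 1 - (n : ℝ) + (σ - 1) = σ - n by ring] at this
        exact this
    _ ≤ ∫ x : EuclideanSpace ℝ (Fin n), g ‖x‖ :=
        setIntegral_le_integral hgint (Filter.Eventually.of_forall hgnn)
    _ = n * (V * ∫ r in (0 : ℝ)..R, M * (D * h r)) := by
        rw [integral_fun_norm_addHaar, setIntegral_congr_fun measurableSet_Ioi hgeq,
          setIntegral_indicator measurableSet_Iio, Set.Ioi_inter_Iio,
          intervalIntegral.integral_of_le hR0.le, integral_Ioc_eq_integral_Ioo]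
        simp [hV]
    _ = n * V * (M * (D * ∫ r in (0 : ℝ)..R, h r)) := by
        rw [intervalIntegral.integral_const_mul, intervalIntegral.integral_const_mul, mul_assoc]
    _ ≤ n * V * (M * (D * (Q * L ^ (σ - 1)))) := by
        have hle' : ∫ r in (0 : ℝ)..R, h r ≤ Q * L ^ (σ - 1) := hle
        gcongr
    _ ≤ _ := by
        have : 0 ≤ M * L ^ (σ - 1) := by positivity
        nlinarith

theorem add_rpow_le_of_half_le {T t lam : ℝ} (e : ℝ) (hT : 1 ≤ T) (hlam : 1 < lam)
    (ht1 : T / 2 ≤ t) (ht2 : t ≤ T) :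
    (t + lam) ^ e ≤ (2 * (1 + lam)) ^ |e| * T ^ e :=
  rpow_le_abs_rpow_mul_rpow _ (by linarith) (by linarith) (by nlinarith) (by nlinarith)

theorem exists_integral_time_ball_le {n : ℕ} (hn : 1 ≤ n) {σ q lam : ℝ} (hσ : 0 < σ)
    (hq : 1 < q) (hlam : 1 < lam) :
    ∃ C : ℝ, 0 < C ∧ ∀ (T M : ℝ) (f : ℝ → EuclideanSpace ℝ (Fin n) → ℝ), 1 ≤ T → 0 ≤ M →
      (∀ t x, T / 2 ≤ t → t ≤ T → 0 < ‖x‖ → ‖x‖ < 1 + t → 0 ≤ f t x ∧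
        f t x ≤ M * (‖x‖ ^ (σ - n) * (t + lam - ‖x‖) ^ (-q))) →
      0 ≤ ∫ t in (T / 2)..T, ∫ x in Metric.ball (0 : EuclideanSpace ℝ (Fin n)) (1 + t), f t x ∧
      ∫ t in (T / 2)..T, ∫ x in Metric.ball (0 : EuclideanSpace ℝ (Fin n)) (1 + t), f t x
        ≤ C * M * T ^ σ := by
  obtain ⟨C, hC, h⟩ := exists_integral_ball_le hn hσ hq hlam
  refine ⟨C * (2 * (1 + lam)) ^ |σ - 1|, by positivity, ?_⟩
  intro T M f hT hM hf
  have hT0 : 0 < T := by linarith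
  have hb : ∀ t, T / 2 ≤ t → t ≤ T →
      0 ≤ ∫ x in Metric.ball (0 : EuclideanSpace ℝ (Fin n)) (1 + t), f t x ∧
      ∫ x in Metric.ball (0 : EuclideanSpace ℝ (Fin n)) (1 + t), f t x
        ≤ C * M * ((2 * (1 + lam)) ^ |σ - 1| * T ^ (σ - 1)) := by
    intro t ht1 ht2
    obtain ⟨h1, h2⟩ := h t M (f t) (by linarith) hM fun x hx hx' => hf t x ht1 ht2 hx hx'
    refine ⟨h1, h2.trans (mul_le_mul_of_nonneg_left ?_ (by positivity))⟩
    exact add_rpow_le_of_half_le _ hT hlam ht1 ht2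
  refine ⟨intervalIntegral.integral_nonneg (by linarith) fun t ht => (hb t ht.1 ht.2).1, ?_⟩
  refine (Real.le_norm_self _).trans ((intervalIntegral.norm_integral_le_of_norm_le_const
    (C := C * M * ((2 * (1 + lam)) ^ |σ - 1| * T ^ (σ - 1))) ?_).trans ?_)
  · intro t ht
    rw [Set.uIoc_of_le (by linarith)] at ht
    obtain ⟨h1, h2⟩ := hb t ht.1.le ht.2
    rwa [Real.norm_eq_abs, abs_of_nonneg h1]
  · rw [show T - T / 2 = T / 2 by ring, abs_of_pos (half_pos hT0)]
    have e : T ^ σ = T ^ (σ - 1) * T := by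
      rw [← Real.rpow_add_one hT0.ne', sub_add_cancel]
    rw [e]
    have : 0 ≤ C * M * ((2 * (1 + lam)) ^ |σ - 1| * T ^ (σ - 1)) * T := by positivity
    linarith

theorem rpow_mul_rpow_neg_le {p p' A₀ c ρ κ β b r L a Y Z : ℝ} (hp' : 0 < p') (hp : 0 < p)
    (hpp : p' - p' / p = 1) (hA₀ : 0 ≤ A₀) (hc : 0 < c) (hr : 0 < r) (hL : 0 < L) (ha : 0 < a)
    (hY0 : 0 ≤ Y) (hY : Y ≤ A₀ * (L / r * r ^ ρ * (L ^ (-κ) * a ^ (κ - b))))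
    (hZ : c * (r ^ ρ * L ^ (-β)) ≤ Z) :
    0 ≤ Y ^ p' * Z ^ (-(p' / p)) ∧
    Y ^ p' * Z ^ (-(p' / p)) ≤ A₀ ^ p' * c ^ (-(p' / p)) * L ^ (p' - κ * p' + β * p' / p) *
      (r ^ (ρ - p') * a ^ (-((b - κ) * p'))) := by
  have hZ0 : 0 < Z := lt_of_lt_of_le (by positivity) hZ
  refine ⟨by positivity, ?_⟩
  have h1 := Real.rpow_le_rpow hY0 hY hp'.le
  have h2 := Real.rpow_le_rpow_of_nonpos (by positivity) hZ
    (show -(p' / p) ≤ 0 by have := div_pos hp' hp; linarith)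
  refine (mul_le_mul h1 h2 (by positivity) (by positivity)).trans (le_of_eq ?_)
  rw [Real.mul_rpow hA₀ (by positivity), Real.mul_rpow (by positivity) (by positivity),
    Real.mul_rpow (by positivity) (by positivity), Real.mul_rpow (by positivity) (by positivity),
    Real.div_rpow hL.le hr.le, Real.mul_rpow hc.le (by positivity),
    Real.mul_rpow (by positivity) (by positivity), ← Real.rpow_mul hr.le, ← Real.rpow_mul hL.le,
    ← Real.rpow_mul ha.le, ← Real.rpow_mul hr.le, ← Real.rpow_mul hL.le]
  have e1 : L ^ (p' - κ * p' + β * p' / p) = L ^ p' * L ^ (-κ * p') * L ^ (-β * -(p' / p)) := by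
    rw [← Real.rpow_add hL, ← Real.rpow_add hL]; congr 1; ring
  have e2 : r ^ (ρ - p') = (r ^ p')⁻¹ * r ^ (ρ * p') * r ^ (ρ * -(p' / p)) := by
    rw [← Real.rpow_neg hr.le, ← Real.rpow_add hr, ← Real.rpow_add hr]; congr 1
    linear_combination -ρ * hpp
  have e3 : -((b - κ) * p') = (κ - b) * p' := by ring
  rw [e1, e2, e3]
  ring

/-- Comparison of `Ψ_{β₁}`, of its time derivative and of `Ψ_β` with the same model weight. -/
theorem exists_Psi_bounds (n : ℕ) {α γ : ℝ} (ρ : ℝ) {lam β₁ : ℝ} (β : ℝ) (hα : 0 < α) (hγ : α < γ)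
    (hlam : 1 < lam) (hβ₁ : γ - α < β₁ + 1) :
    ∃ A₁ c : ℝ, 0 < A₁ ∧ 0 < c ∧ ∀ (t : ℝ) (x : EuclideanSpace ℝ (Fin n)), 0 < t → 0 < ‖x‖ →
      ‖x‖ < 1 + t →
      (0 ≤ Psi n α γ ρ β₁ lam t x) ∧
      (‖x‖⁻¹ * Psi n α γ ρ β₁ lam t x ≤ A₁ * ((t + lam) / ‖x‖ * ‖x‖ ^ ρ *
        ((t + lam) ^ (-(γ - α)) * (t + lam - ‖x‖) ^ ((γ - α) - (β₁ + 1))))) ∧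
      (|deriv (fun t' => Psi n α γ ρ β₁ lam t' x) t| ≤ A₁ * ((t + lam) / ‖x‖ * ‖x‖ ^ ρ *
        ((t + lam) ^ (-(γ - α)) * (t + lam - ‖x‖) ^ ((γ - α) - (β₁ + 1))))) ∧
      (c * (‖x‖ ^ ρ * (t + lam) ^ (-β)) ≤ Psi n α γ ρ β lam t x) := by
  have hκ : 0 < γ - α := sub_pos.2 hγ
  obtain ⟨C, hC, hup⟩ := exists_eulerInt_le hα hκ hβ₁
  obtain ⟨c, hc, hlow⟩ := exists_le_eulerInt hα hκ β
  set G := Real.Gamma γ / (Real.Gamma α * Real.Gamma (γ - α)) with hG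
  have hG0 : 0 < G := div_pos (Real.Gamma_pos_of_pos (hα.trans hγ))
    (mul_pos (Real.Gamma_pos_of_pos hα) (Real.Gamma_pos_of_pos hκ))
  refine ⟨G * C * (2 + |β₁|), G * c, by positivity, by positivity, ?_⟩
  intro t x ht hx hxt
  have hrL : ‖x‖ < t + lam := by linarith
  have hL : 0 < t + lam := by linarith
  have ha : 0 < t + lam - ‖x‖ := by linarith
  have hr := norm_nonneg x
  set W := (t + lam) ^ (-(γ - α)) * (t + lam - ‖x‖) ^ ((γ - α) - (β₁ + 1)) with hW
  have hW0 : 0 < W := by positivity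
  have hrρ : 0 < ‖x‖ ^ ρ := by positivity
  have hup' := hup (t + lam) ‖x‖ hr hrL
  have hLr : 1 ≤ (t + lam) / ‖x‖ := by rw [one_le_div hx]; exact hrL.le
  rw [deriv_Psi n β₁ hα hγ hrL, Psi_eq_eulerInt n hrL, Psi_eq_eulerInt n hrL,
    Psi_eq_eulerInt n hrL, ← hG]
  have hJ0 : 0 ≤ eulerInt α (γ - α) β₁ (t + lam) ‖x‖ := eulerInt_nonneg hr hrL
  have hJ1 : 0 ≤ eulerInt α (γ - α) (β₁ + 1) (t + lam) ‖x‖ := eulerInt_nonneg hr hrL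
  refine ⟨by positivity, ?_, ?_, ?_⟩
  · have h1 : eulerInt α (γ - α) β₁ (t + lam) ‖x‖ ≤ 2 * (t + lam) * (C * W) :=
      (eulerInt_le_mul_eulerInt_add_one hα hκ β₁ hr hrL).trans
        (mul_le_mul_of_nonneg_left hup' (by positivity))
    calc _ ≤ ‖x‖⁻¹ * (G * (‖x‖ ^ ρ * (2 * (t + lam) * (C * W)))) := by gcongr
      _ = G * C * 2 * ((t + lam) / ‖x‖ * ‖x‖ ^ ρ * W) := by ring
      _ ≤ _ := by
        gcongr
        linarith [abs_nonneg β₁]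
  · rw [abs_mul, abs_neg, abs_of_nonneg (a := G * _) (by positivity)]
    calc _ ≤ |β₁| * (G * (‖x‖ ^ ρ * (C * W))) := by gcongr
      _ = G * C * |β₁| * (1 * ‖x‖ ^ ρ * W) := by ring
      _ ≤ _ := by
        gcongr
        linarith
  · have := hlow (t + lam) ‖x‖ hr hrL
    calc _ = G * (‖x‖ ^ ρ * (c * (t + lam) ^ (-β))) := by ring
      _ ≤ _ := by gcongr

/-- with `β₁ > γ − α − 1/p`, there is a constant `C`
independent of `T` such that
`S(T;β₁,β) ≤ C T^((ρ+n)/p' − (n−A+2ρ+1)/2 + β/p)` for all `T ≥ 1`. -/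
theorem stmt10 (n : ℕ) (hn : 1 ≤ n) (A B : ℝ)
    (hB : -((n : ℝ) - 2) ^ 2 / 4 < B)
    (ρ : ℝ) (hρ : ρ = ((2 - (n : ℝ)) + Real.sqrt (((n : ℝ) - 2) ^ 2 + 4 * B)) / 2)
    (hA0 : 0 ≤ A) (hA1 : A < (n : ℝ) - 1 + 2 * ρ)
    (α γ : ℝ) (hα : α = ((n : ℝ) + A - 1 + 2 * ρ) / 2) (hγ : γ = (n : ℝ) - 1 + 2 * ρ)
    (lam : ℝ) (hlam : 1 < lam)
    (p : ℝ) (hp : ((n : ℝ) + ρ) / ((n : ℝ) + ρ - 1) < p)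
    (p' : ℝ) (hp' : p' = p / (p - 1))
    (β : ℝ) (hβ : β < γ - α)
    (β₁ : ℝ) (hβ₁ : γ - α - 1 / p < β₁) :
    ∃ C : ℝ, 0 < C ∧ ∀ T : ℝ, 1 ≤ T →
      Sfun n α γ ρ lam p p' β₁ β T
        ≤ C * T ^ ((ρ + n) / p' - ((n : ℝ) - A + 2 * ρ + 1) / 2 + β / p) := by
  have hD : 0 < ((n : ℝ) - 2) ^ 2 + 4 * B := by linarith
  have hsq := Real.sqrt_pos.2 hD
  have hn1 : (1 : ℝ) ≤ n := by exact_mod_cast hn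
  have hα0 : 0 < α := by rw [hα]; linarith
  have hγα : α < γ := by rw [hα, hγ]; linarith
  have hd : 0 < (n : ℝ) + ρ - 1 := by rw [hρ]; linarith
  have hp1 : 1 < p := lt_of_le_of_lt (by rw [one_le_div hd]; linarith) hp
  have hp0 : 0 < p := by linarith
  have hp10 : 0 < p - 1 := by linarith
  have hp'0 : 0 < p' := by rw [hp']; positivity
  have hpp : p' - p' / p = 1 := by rw [hp']; field_simp
  have hinv : 1 / p + 1 / p' = 1 := by rw [hp']; field_simp; ring
  have hσ : 0 < (n : ℝ) + ρ - p' := by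
    rw [div_lt_iff₀ hd] at hp
    rw [hp', sub_pos, div_lt_iff₀ hp10]
    linarith
  have hq : 1 < (β₁ + 1 - (γ - α)) * p' := by
    rw [← div_lt_iff₀ hp'0]; linarith
  obtain ⟨A₁, c, hA₁, hc, hPsi⟩ := exists_Psi_bounds n ρ β hα0 hγα hlam
    (show γ - α < β₁ + 1 by have := one_div_pos.2 hp'0; linarith)
  obtain ⟨C, hC, hint⟩ := exists_integral_time_ball_le hn hσ hq hlam
  set w := p' - (γ - α) * p' + β * p' / p with hw
  set E := (ρ + n) / p' - ((n : ℝ) - A + 2 * ρ + 1) / 2 + β / p with hE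
  have hwE : (w + ((n : ℝ) + ρ - p')) * (1 / p') = 1 + E := by
    rw [hw, hE, hα, hγ]; field_simp; ring
  set M₀ := A₁ ^ p' * c ^ (-(p' / p)) * (2 * (1 + lam)) ^ |w| with hM₀
  have hM₀0 : 0 < M₀ := by positivity
  have hterm : ∀ (T M : ℝ) (f : ℝ → EuclideanSpace ℝ (Fin n) → ℝ), 1 ≤ T → 0 ≤ M →
      (∀ t x, T / 2 ≤ t → t ≤ T → 0 < ‖x‖ → ‖x‖ < 1 + t → 0 ≤ f t x ∧
        f t x ≤ M * T ^ w * (‖x‖ ^ (ρ - p') *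
          (t + lam - ‖x‖) ^ (-((β₁ + 1 - (γ - α)) * p')))) →
      (∫ t in (T / 2)..T, ∫ x in Metric.ball (0 : EuclideanSpace ℝ (Fin n)) (1 + t), f t x)
        ^ (1 / p') ≤ (C * M) ^ (1 / p') * (T * T ^ E) := by
    intro T M f hT hM hf
    have hT0 : 0 < T := by linarith
    obtain ⟨h1, h2⟩ := hint T (M * T ^ w) f hT (by positivity) (by
      rwa [show (n : ℝ) + ρ - p' - n = ρ - p' by ring])
    refine (Real.rpow_le_rpow h1 h2 (by positivity)).trans (le_of_eq ?_)
    rw [show C * (M * T ^ w) * T ^ ((n : ℝ) + ρ - p') = C * M * T ^ (w + ((n : ℝ) + ρ - p')) by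
      rw [Real.rpow_add hT0 w]; ring, Real.mul_rpow (by positivity) (by positivity),
      ← Real.rpow_mul hT0.le, hwE, Real.rpow_add hT0, Real.rpow_one]
  have hpt : ∀ T t : ℝ, ∀ x : EuclideanSpace ℝ (Fin n), 1 ≤ T → T / 2 ≤ t → t ≤ T → 0 < ‖x‖ →
      ‖x‖ < 1 + t → ∀ Y, 0 ≤ Y → Y ≤ A₁ * ((t + lam) / ‖x‖ * ‖x‖ ^ ρ *
        ((t + lam) ^ (-(γ - α)) * (t + lam - ‖x‖) ^ ((γ - α) - (β₁ + 1)))) →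
      0 ≤ Y ^ p' * Psi n α γ ρ β lam t x ^ (-(p' / p)) ∧
      Y ^ p' * Psi n α γ ρ β lam t x ^ (-(p' / p)) ≤ M₀ * T ^ w * (‖x‖ ^ (ρ - p') *
          (t + lam - ‖x‖) ^ (-((β₁ + 1 - (γ - α)) * p'))) := by
    intro T t x hT ht1 ht2 hx hxt Y hY0 hY
    have hT0 : 0 < T := by linarith
    have ha : 0 < t + lam - ‖x‖ := by linarith
    have hL : 0 < t + lam := by linarith
    obtain ⟨h1, h2⟩ := rpow_mul_rpow_neg_le hp'0 hp0 hpp hA₁.le hc hx hL ha hY0 hY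
      (hPsi t x (by linarith) hx hxt).2.2.2
    refine ⟨h1, h2.trans ?_⟩
    have h3 : (t + lam) ^ w ≤ (2 * (1 + lam)) ^ |w| * T ^ w :=
      add_rpow_le_of_half_le w hT hlam ht1 ht2
    refine mul_le_mul_of_nonneg_right ?_ (by positivity)
    rw [hM₀, mul_assoc _ ((2 * (1 + lam)) ^ |w|)]
    exact mul_le_mul_of_nonneg_left h3 (by positivity)
  have hpt₂ : ∀ T t : ℝ, ∀ x : EuclideanSpace ℝ (Fin n), 1 ≤ T → T / 2 ≤ t → t ≤ T → 0 < ‖x‖ →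
      ‖x‖ < 1 + t →
      0 ≤ ‖x‖ ^ (-p') * Psi n α γ ρ β₁ lam t x ^ p' * Psi n α γ ρ β lam t x ^ (-(p' / p)) ∧
      ‖x‖ ^ (-p') * Psi n α γ ρ β₁ lam t x ^ p' * Psi n α γ ρ β lam t x ^ (-(p' / p))
        ≤ M₀ * T ^ w * (‖x‖ ^ (ρ - p') *
          (t + lam - ‖x‖) ^ (-((β₁ + 1 - (γ - α)) * p'))) := by
    intro T t x hT ht1 ht2 hx hxt
    obtain ⟨h0, h1, -, -⟩ := hPsi t x (by linarith) hx hxt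
    have e : ‖x‖ ^ (-p') * Psi n α γ ρ β₁ lam t x ^ p'
        = (‖x‖⁻¹ * Psi n α γ ρ β₁ lam t x) ^ p' := by
      rw [Real.mul_rpow (by positivity) h0, Real.inv_rpow hx.le, Real.rpow_neg hx.le]
    rw [e]
    exact hpt T t x hT ht1 ht2 hx hxt _ (by positivity) h1
  refine ⟨2 * (C * M₀) ^ (1 / p') + (C * M₀) ^ (1 / p') + (C * M₀) ^ (1 / p'),
    by positivity, ?_⟩
  intro T hT
  have hT0 : 0 < T := by linarith
  have hI₁ := hterm T ((2 * T) ^ p' * M₀) (fun t x =>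
    Psi n α γ ρ β₁ lam t x ^ p' * Psi n α γ ρ β lam t x ^ (-(p' / p))) hT (by positivity) (by
      intro t x ht1 ht2 hx hxt
      obtain ⟨h1, h2⟩ := hpt₂ T t x hT ht1 ht2 hx hxt
      have hx2 : ‖x‖ ^ p' ≤ (2 * T) ^ p' :=
        Real.rpow_le_rpow hx.le (by linarith) hp'0.le
      have e : Psi n α γ ρ β₁ lam t x ^ p' * Psi n α γ ρ β lam t x ^ (-(p' / p))
          = ‖x‖ ^ p' * (‖x‖ ^ (-p') * Psi n α γ ρ β₁ lam t x ^ p' *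
            Psi n α γ ρ β lam t x ^ (-(p' / p))) := by
        have : ‖x‖ ^ p' * ‖x‖ ^ (-p') = 1 := by rw [← Real.rpow_add hx]; simp
        linear_combination (-Psi n α γ ρ β₁ lam t x ^ p' *
          Psi n α γ ρ β lam t x ^ (-(p' / p))) * this
      rw [e]
      refine ⟨mul_nonneg (by positivity) h1, ?_⟩
      rw [mul_assoc ((2 * T) ^ p'), mul_assoc ((2 * T) ^ p')]
      exact mul_le_mul hx2 h2 h1 (by positivity))
  have hI₂ := hterm T M₀ _ hT hM₀0.le fun t x => hpt₂ T t x hT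
  have hI₃ := hterm T M₀ (fun t x => |deriv (fun t' => Psi n α γ ρ β₁ lam t' x) t| ^ p' *
    Psi n α γ ρ β lam t x ^ (-(p' / p))) hT hM₀0.le fun t x ht1 ht2 hx hxt =>
      hpt T t x hT ht1 ht2 hx hxt _ (abs_nonneg _) (hPsi t x (by linarith) hx hxt).2.2.1
  have e1 : (C * ((2 * T) ^ p' * M₀)) ^ (1 / p') = 2 * T * (C * M₀) ^ (1 / p') := by
    rw [mul_left_comm, Real.mul_rpow (by positivity) (by positivity), ← Real.rpow_mul (by positivity),
      mul_one_div_cancel hp'0.ne', Real.rpow_one]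
  rw [e1] at hI₁
  unfold Sfun
  have hT2 : T ^ (-2 : ℝ) = T⁻¹ * T⁻¹ := by
    rw [← Real.rpow_neg_one, ← Real.rpow_add hT0]; norm_num
  rw [hT2, Real.rpow_neg_one]
  have k1 := mul_le_mul_of_nonneg_left hI₁ (show 0 ≤ T⁻¹ * T⁻¹ by positivity)
  have k2 := mul_le_mul_of_nonneg_left hI₂ (show 0 ≤ T⁻¹ by positivity)
  have k3 := mul_le_mul_of_nonneg_left hI₃ (show 0 ≤ T⁻¹ by positivity)
  refine (add_le_add (add_le_add k1 k2) k3).trans (le_of_eq ?_)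
  field_simp
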